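/- Let K, Q be positive integers with Q ≤ K, and let a_{K−Q+1},…,a_K be nonnegative rational numbers with N := ∑_{u=K−Q+1}^{K} a_u > 0. Suppose ∑_{u=K−Q+1}^{K} u·a_u = r·N for some integer r with K−Q+1 ≤ r ≤ K, and that ∑_{u=K−Q+1}^{K} a_u · Z_K^Q(u) = N · Z_K^Q(r). Then a_r = N and a_u = 0 for every u ∈ [K−Q+1, K] with u ≠ r. -/

import Mathlib

/-- The rational sequence `Z_K^Q(u)` from the paper:
`Z_K^Q(u) = ∑_{l=u+Q−K}^{min(u,Q)} ((Q−l)/(Q·l))·C(u,l)·C(K−u,Q−l)`. -/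
def Z (K Q u : ℕ) : ℚ :=
  ∑ l ∈ Finset.Icc (u + Q - K) (min u Q),
    (((Q : ℚ) - (l : ℚ)) / ((Q : ℚ) * (l : ℚ))) * (u.choose l : ℚ) *
      ((K - u).choose (Q - l) : ℚ)

/-- The Vandermonde-type sum `∑_{i+j=q} f(i)·C(u,i)·C(n,j)`. -/
def weightedVandermonde (f : ℕ → ℚ) (n u q : ℕ) : ℚ :=
  ∑ p ∈ Finset.HasAntidiagonal.antidiagonal q, f p.1 * (u.choose p.1 : ℚ) * (n.choose p.2 : ℚ)

theorem weightedVandermonde_succ_right (f : ℕ → ℚ) (n u q : ℕ) :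
    weightedVandermonde f (n + 1) u (q + 1) =
      weightedVandermonde f n u (q + 1) + weightedVandermonde f n u q := by
  simp only [weightedVandermonde, Finset.Nat.sum_antidiagonal_succ', Nat.choose_succ_succ,
    Nat.choose_zero_right, Nat.cast_add, mul_add, Finset.sum_add_distrib]
  ring

theorem weightedVandermonde_succ_left (f : ℕ → ℚ) (n u q : ℕ) :
    weightedVandermonde f n (u + 1) (q + 1) =
      weightedVandermonde f n u (q + 1) + weightedVandermonde (fun i => f (i + 1)) n u q := by
  simp only [weightedVandermonde, Finset.Nat.sum_antidiagonal_succ, Nat.choose_succ_succ,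
    Nat.choose_zero_right, Nat.cast_add, mul_add, add_mul, Finset.sum_add_distrib]
  ring

/-- The second difference of the Vandermonde-type sum along `n + u = const` is the sum
weighted by the second difference of `f`. -/
theorem weightedVandermonde_second_difference (f : ℕ → ℚ) (n u q : ℕ) :
    weightedVandermonde f n (u + 2) (q + 2) - 2 * weightedVandermonde f (n + 1) (u + 1) (q + 2) +
        weightedVandermonde f (n + 2) u (q + 2) =
      weightedVandermonde (fun i => f (i + 2) - 2 * f (i + 1) + f i) n u q := by
  have hlin : weightedVandermonde (fun i => f (i + 2) - 2 * f (i + 1) + f i) n u q =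
      weightedVandermonde (fun i => f (i + 2)) n u q -
        2 * weightedVandermonde (fun i => f (i + 1)) n u q + weightedVandermonde f n u q := by
    simp only [weightedVandermonde, Finset.mul_sum, ← Finset.sum_sub_distrib,
      ← Finset.sum_add_distrib]
    exact Finset.sum_congr rfl fun p _ => by ring
  rw [hlin]
  simp only [weightedVandermonde_succ_right, weightedVandermonde_succ_left]
  ring

theorem weightedVandermonde_pos {f : ℕ → ℚ} {n u q : ℕ} (hf : ∀ i, 0 < i → 0 < f i)
    (hn : n < q) (hq : q ≤ n + u) : 0 < weightedVandermonde f n u q := by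
  refine Finset.sum_pos' (fun p hp => ?_) ⟨(q - n, n), ?_, ?_⟩
  · rcases Nat.eq_zero_or_pos p.1 with h | h
    · have : n < p.2 := by
        have := Finset.HasAntidiagonal.mem_antidiagonal.mp hp
        omega
      simp [Nat.choose_eq_zero_of_lt this]
    · have := hf _ h
      positivity
  · simp only [Finset.HasAntidiagonal.mem_antidiagonal]
    omega
  · have h₁ := hf (q - n) (by omega)
    have h₂ : 0 < u.choose (q - n) := Nat.choose_pos (by omega)
    simp only [Nat.choose_self, Nat.cast_one, mul_one]
    positivity

theorem Z_eq_weightedVandermonde {K Q u : ℕ} (hu : u ≤ K) :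
    Z K Q u =
      weightedVandermonde (fun l => ((Q : ℚ) - (l : ℚ)) / ((Q : ℚ) * (l : ℚ))) (K - u) u Q := by
  rw [weightedVandermonde, Finset.Nat.sum_antidiagonal_eq_sum_range_succ_mk, Z]
  refine Finset.sum_subset (fun l hl => ?_) fun l hl hl' => ?_
  · simp only [Finset.mem_Icc, Finset.mem_range] at *
    omega
  · simp only [Finset.mem_Icc, Finset.mem_range] at *
    rcases lt_or_ge u l with h | h
    · simp [Nat.choose_eq_zero_of_lt h]
    · have : K - u < Q - l := by omega
      simp [Nat.choose_eq_zero_of_lt this]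

theorem Z_second_difference_pos {K Q u : ℕ} (hQK : Q ≤ K) (hu : K - Q + 1 ≤ u)
    (huK : u + 2 ≤ K) : 0 < Z K Q (u + 2) - 2 * Z K Q (u + 1) + Z K Q u := by
  obtain ⟨n, rfl⟩ := Nat.exists_eq_add_of_le huK
  obtain ⟨q, rfl⟩ : ∃ q, Q = q + 2 := ⟨Q - 2, by omega⟩
  rw [Z_eq_weightedVandermonde (by omega), Z_eq_weightedVandermonde (by omega),
    Z_eq_weightedVandermonde (by omega), show u + 2 + n - (u + 2) = n by omega,
    show u + 2 + n - (u + 1) = n + 1 by omega, show u + 2 + n - u = n + 2 by omega,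
    weightedVandermonde_second_difference]
  refine weightedVandermonde_pos (fun i hi => ?_) (by omega) (by omega)
  have hi' : (0 : ℚ) < i := by exact_mod_cast hi
  have key : (((q + 2 : ℕ) : ℚ) - ((i + 2 : ℕ) : ℚ)) / (((q + 2 : ℕ) : ℚ) * ((i + 2 : ℕ) : ℚ)) -
      2 * ((((q + 2 : ℕ) : ℚ) - ((i + 1 : ℕ) : ℚ)) / (((q + 2 : ℕ) : ℚ) * ((i + 1 : ℕ) : ℚ))) +
      (((q + 2 : ℕ) : ℚ) - (i : ℚ)) / (((q + 2 : ℕ) : ℚ) * (i : ℚ)) =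
      2 / ((i : ℚ) * (i + 1) * (i + 2)) := by
    push_cast
    field_simp
    ring
  rw [key]
  positivity

/-- A strictly convex sequence on an integer interval has at each point a supporting line that
touches it nowhere else. -/
theorem exists_strict_support_of_second_difference_pos {g : ℕ → ℚ} {A B r : ℕ}
    (hg : ∀ u, A ≤ u → u + 2 ≤ B → 0 < g (u + 2) - 2 * g (u + 1) + g u)
    (hAr : A ≤ r) (hrB : r ≤ B) :
    ∃ d : ℚ, ∀ s ∈ Finset.Icc A B, s ≠ r → g r + d * ((s : ℚ) - r) < g s := by
  obtain ⟨d, hright, hleft⟩ : ∃ d : ℚ, (r + 1 ≤ B → d < g (r + 1) - g r) ∧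
      (∀ t, A ≤ t → t + 1 = r → g (t + 1) - g t < d) := by
    rcases hAr.eq_or_lt with rfl | hlt
    · exact ⟨g (A + 1) - g A - 1, fun _ => by linarith, fun t _ _ => by omega⟩
    · obtain ⟨t, rfl⟩ : ∃ t, r = t + 1 := ⟨r - 1, by omega⟩
      rcases hrB.eq_or_lt with h | h
      · refine ⟨g (t + 1) - g t + 1, fun _ => by omega, fun v _ hv => ?_⟩
        obtain rfl : v = t := by omega
        linarith
      · have := hg t (by omega) (by omega)
        obtain ⟨d, h₁, h₂⟩ := exists_between
          (show g (t + 1) - g t < g (t + 1 + 1) - g (t + 1) by linarith)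
        refine ⟨d, fun _ => h₂, fun v _ hv => ?_⟩
        obtain rfl : v = t := by omega
        exact h₁
  have hup : ∀ k, r + k + 1 ≤ B → d < g (r + k + 1) - g (r + k) ∧
      g r + d * (k + 1) < g (r + k + 1) := by
    intro k
    induction k with
    | zero =>
      intro h
      have := hright h
      simp only [Nat.cast_zero, add_zero, zero_add, mul_one]
      exact ⟨this, by linarith⟩
    | succ k ih =>
      intro h
      obtain ⟨h₁, h₂⟩ := ih (by omega)
      have h₃ := hg (r + k) (by omega) (by omega)
      rw [show r + (k + 1) + 1 = r + k + 2 by omega, show r + (k + 1) = r + k + 1 by omega]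
      push_cast
      exact ⟨by linarith, by linarith⟩
  have hdown : ∀ k t, A ≤ t → t + k + 1 = r → g (t + 1) - g t < d ∧
      g r - d * (k + 1) < g t := by
    intro k
    induction k with
    | zero =>
      intro t ht h
      have := hleft t ht h
      subst h
      simp only [Nat.cast_zero, add_zero, zero_add, mul_one]
      exact ⟨this, by linarith⟩
    | succ k ih =>
      intro t ht h
      obtain ⟨h₁, h₂⟩ := ih (t + 1) (by omega) (by omega)
      have h₃ := hg t ht (by omega)
      rw [show t + 1 + 1 = t + 2 by omega] at h₁
      push_cast
      exact ⟨by linarith, by linarith⟩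
  refine ⟨d, fun s hs hsr => ?_⟩
  obtain ⟨hAs, hsB⟩ := Finset.mem_Icc.mp hs
  rcases lt_or_gt_of_ne hsr with h | h
  · obtain ⟨k, rfl⟩ := Nat.exists_eq_add_of_lt h
    have := (hdown k s hAs rfl).2
    push_cast
    linarith
  · obtain ⟨k, rfl⟩ := Nat.exists_eq_add_of_lt h
    have := (hup k hsB).2
    push_cast
    linarith

/-- equality case of the Jensen-type bound: let `K, Q` be positive
integers with `Q ≤ K`, and let `a_{K−Q+1},…,a_K` be nonnegative rationals with
`N = ∑ a_u > 0`, `∑ u·a_u = r·N` for an integer `K−Q+1 ≤ r ≤ K`, and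
`∑ a_u · Z_K^Q(u) = N · Z_K^Q(r)`.  Then `a_r = N` and `a_u = 0` for every other `u`
in `[K−Q+1, K]`. -/
theorem Z_jensen_equality_case (K Q : ℕ) (hK : 0 < K) (hQ : 0 < Q) (hQK : Q ≤ K)
    (a : ℕ → ℚ) (ha : ∀ u ∈ Finset.Icc (K - Q + 1) K, 0 ≤ a u)
    (N : ℚ) (hN : N = ∑ u ∈ Finset.Icc (K - Q + 1) K, a u) (hNpos : 0 < N)
    (r : ℕ) (hr1 : K - Q + 1 ≤ r) (hr2 : r ≤ K)
    (hmean : ∑ u ∈ Finset.Icc (K - Q + 1) K, (u : ℚ) * a u = (r : ℚ) * N)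
    (heq : ∑ u ∈ Finset.Icc (K - Q + 1) K, a u * Z K Q u = N * Z K Q r) :
    a r = N ∧ ∀ u ∈ Finset.Icc (K - Q + 1) K, u ≠ r → a u = 0 := by
  obtain ⟨d, hd⟩ := exists_strict_support_of_second_difference_pos (g := Z K Q)
    (fun u hu huK => Z_second_difference_pos hQK hu huK) hr1 hr2
  have hr : r ∈ Finset.Icc (K - Q + 1) K := Finset.mem_Icc.mpr ⟨hr1, hr2⟩
  have hgap : ∀ u ∈ Finset.Icc (K - Q + 1) K,
      0 ≤ a u * (Z K Q u - (Z K Q r + d * ((u : ℚ) - r))) := by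
    intro u hu
    refine mul_nonneg (ha u hu) ?_
    rcases eq_or_ne u r with rfl | hur
    · simp
    · linarith [hd u hu hur]
  have hsum : ∑ u ∈ Finset.Icc (K - Q + 1) K,
      a u * (Z K Q u - (Z K Q r + d * ((u : ℚ) - r))) = 0 := by
    have hexpand : ∀ u ∈ Finset.Icc (K - Q + 1) K,
        a u * (Z K Q u - (Z K Q r + d * ((u : ℚ) - r))) =
          a u * Z K Q u - d * ((u : ℚ) * a u) - (Z K Q r - d * r) * a u := fun u _ => by ring
    rw [Finset.sum_congr rfl hexpand, Finset.sum_sub_distrib, Finset.sum_sub_distrib,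
      ← Finset.mul_sum, ← Finset.mul_sum, heq, hmean, ← hN]
    ring
  have hzero : ∀ u ∈ Finset.Icc (K - Q + 1) K, u ≠ r → a u = 0 := by
    intro u hu hur
    have hu0 := (Finset.sum_eq_zero_iff_of_nonneg hgap).mp hsum u hu
    exact (mul_eq_zero.mp hu0).resolve_right (sub_pos.mpr (hd u hu hur)).ne'
  refine ⟨?_, hzero⟩
  rw [hN, Finset.sum_eq_single_of_mem r hr hzero]
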